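/- Let N ≥ 1 and c ∈ ℝ with c + 1 > 0, and write c⁺ = max(c,0). Let q ∈ (2,∞) satisfy 1/q ≥ 1/2 − 1/(N+1+c⁺), and set θ = (N+1+c⁺)(1/2 − 1/q) ∈ (0,1]. Then there exists a constant C = C(q,c,N) > 0 such that for every u ∈ 𝒞 one has (∫_{ℝ^{N+1}_+} |u|^q (min(1,y))^c dx dy)^{1/q} ≤ C (‖u‖_μ + ‖∇u‖_μ)^{θ} ‖u‖_μ^{1−θ}, where ‖w‖_μ = (∫_{ℝ^{N+1}_+} |w|² (min(1,y))^c dx dy)^{1/2}. -/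

import Mathlib

open MeasureTheory Real

noncomputable section

/-- The upper half-space `ℝ^{N+1}_+`. -/
def HS (N : ℕ) : Set ((Fin N → ℝ) × ℝ) := {z | 0 < z.2}

/-- Partial derivative of `u` in the `i`-th `x` direction. -/
def pXc {N : ℕ} (u : ((Fin N → ℝ) × ℝ) → ℂ) (i : Fin N) (z : (Fin N → ℝ) × ℝ) : ℂ :=
  fderiv ℝ u z (Pi.single i 1, 0)

/-- Partial derivative of `u` in the `y` direction. -/
def pYc {N : ℕ} (u : ((Fin N → ℝ) × ℝ) → ℂ) (z : (Fin N → ℝ) × ℝ) : ℂ :=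
  fderiv ℝ u z (0, 1)

/-- Squared Euclidean norm of the full gradient `∇u`. -/
def gradSqC {N : ℕ} (u : ((Fin N → ℝ) × ℝ) → ℂ) (z : (Fin N → ℝ) × ℝ) : ℝ :=
  (∑ i, ‖pXc u i z‖ ^ 2) + ‖pYc u z‖ ^ 2

/-- The sesquilinear form
`𝔞(u,v) = ∫ ⟨∇u, ∇v̄⟩ y^c + 2 ∫ (D_y u)(a·∇_x v̄) y^c` on the half-space. -/
def aForm (N : ℕ) (c : ℝ) (a : Fin N → ℝ) (u v : ((Fin N → ℝ) × ℝ) → ℂ) : ℂ :=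
  (∫ z in HS N, ((∑ i, pXc u i z * (starRingEnd ℂ) (pXc v i z)) +
      pYc u z * (starRingEnd ℂ) (pYc v z)) * ((z.2 ^ c : ℝ) : ℂ)) +
  2 * ∫ z in HS N, (pYc u z * ∑ i, (a i : ℂ) * (starRingEnd ℂ) (pXc v i z)) *
      ((z.2 ^ c : ℝ) : ℂ)

/-- The class `𝒞` of smooth compactly supported functions on the closed half-space
whose `y`-derivative vanishes for `0 ≤ y ≤ δ`, for some `δ > 0`. -/
def memC {N : ℕ} (u : ((Fin N → ℝ) × ℝ) → ℂ) : Prop :=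
  ContDiff ℝ (⊤ : ℕ∞) u ∧ HasCompactSupport u ∧
    ∃ δ > 0, ∀ z : (Fin N → ℝ) × ℝ, 0 ≤ z.2 → z.2 ≤ δ → pYc u z = 0

open scoped ENNReal

/-- The coordinate splitting. -/
def splitMap (N : ℕ) (z : Fin (N + 1) → ℝ) : (Fin N → ℝ) × ℝ := (fun j => z j.succ, z 0)

/-- Family of measures. -/
def measFam (N : ℕ) (ν : Measure ℝ) (i : Fin (N + 1)) : Measure ℝ :=
  if i = 0 then ν else volume

instance measFam_sf (N : ℕ) (ν : Measure ℝ) [SigmaFinite ν] (i : Fin (N + 1)) :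
    SigmaFinite (measFam N ν i) := by
  unfold measFam
  split_ifs <;> infer_instance

lemma splitMap_mp (N : ℕ) (ν : Measure ℝ) [SigmaFinite ν] :
    MeasurePreserving (splitMap N) (Measure.pi (measFam N ν))
      ((volume : Measure (Fin N → ℝ)).prod ν) := by
  have h1 := measurePreserving_piFinSuccAbove (α := fun _ : Fin (N + 1) => ℝ) (measFam N ν) 0
  have h2 : (Measure.pi fun j : Fin N => measFam N ν (Fin.succAbove 0 j))
      = (volume : Measure (Fin N → ℝ)) := by
    rw [volume_pi]
    congr 1
  rw [h2] at h1
  have h3 : measFam N ν 0 = ν := by simp [measFam]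
  rw [h3] at h1
  have h4 := (Measure.measurePreserving_swap (μ := ν)
    (ν := (volume : Measure (Fin N → ℝ)))).comp h1
  exact h4

lemma splitMap_update_zero (N : ℕ) (z : Fin (N + 1) → ℝ) (t : ℝ) :
    splitMap N (Function.update z 0 t) = ((splitMap N z).1, t) := by
  simp [splitMap]

lemma splitMap_update_succ (N : ℕ) (z : Fin (N + 1) → ℝ) (i : Fin N) (t : ℝ) :
    splitMap N (Function.update z i.succ t)
      = (Function.update (splitMap N z).1 i t, (splitMap N z).2) := by
  ext j
  · by_cases h : j = i
    · subst h; simp [splitMap]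
    · simp [splitMap, h]
  · simp [splitMap, Function.update_of_ne (Fin.succ_ne_zero i).symm]

lemma grid (N : ℕ) (hN : 1 ≤ N) (ν : Measure ℝ) [SigmaFinite ν]
    (f F : (Fin N → ℝ) × ℝ → ℝ≥0∞) (hf : Measurable f) (hF : Measurable F)
    (hx : ∀ x y i, f (x, y) ≤ ∫⁻ t, F (Function.update x i t, y))
    (hy : ∀ x y, f (x, y) ≤ ∫⁻ t, F (x, t) ∂ν) :
    ∫⁻ z, f z ^ (((N : ℝ) + 1) / N) ∂((volume : Measure (Fin N → ℝ)).prod ν)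
      ≤ (∫⁻ z, F z ∂((volume : Measure (Fin N → ℝ)).prod ν)) ^ (((N : ℝ) + 1) / N) := by
  have hN' : (0 : ℝ) < N := by exact_mod_cast hN
  have mp := splitMap_mp N ν
  rw [← mp.lintegral_comp hF, ← mp.lintegral_comp (hf.pow_const _)]
  have hp : Real.HolderConjugate (Fintype.card (Fin (N + 1))) (((N : ℝ) + 1) / N) := by
    rw [Real.holderConjugate_iff]
    simp only [Fintype.card_fin]
    push_cast
    constructor
    · linarith
    · field_simp
      ring
  refine le_trans ?_ (lintegral_prod_lintegral_pow_le (measFam N ν) hp (hF.comp mp.measurable))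
  refine lintegral_mono fun z => ?_
  have key : ∀ i, f (splitMap N z) ≤
      ∫⁻ t, (F ∘ splitMap N) (Function.update z i t) ∂(measFam N ν i) := by
    intro i
    refine Fin.cases ?_ (fun i => ?_) i
    · simp only [Function.comp, splitMap_update_zero]
      have h3 : measFam N ν 0 = ν := by simp [measFam]
      rw [h3]
      exact hy _ _
    · simp only [Function.comp, splitMap_update_succ]
      have h3 : measFam N ν i.succ = volume := by simp [measFam]
      rw [h3]
      exact hx _ _ _
  calc f (splitMap N z) ^ (((N : ℝ) + 1) / N)
      = ∏ _i : Fin (N + 1), f (splitMap N z) ^ ((1 : ℝ) / (Fintype.card (Fin (N + 1)) - 1 : ℝ)) := by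
        rw [Finset.prod_const, ← ENNReal.rpow_natCast, ← ENNReal.rpow_mul]
        congr 1
        simp
        field_simp
    _ ≤ _ := by
        refine Finset.prod_le_prod' fun i _ => ?_
        refine ENNReal.rpow_le_rpow (key i) ?_
        simp

lemma enorm_le_Ioi {f : ℝ → ℝ} (hf : ContDiff ℝ 1 f) (h2f : HasCompactSupport f) (x : ℝ) :
    ‖f x‖ₑ ≤ ∫⁻ y in Set.Ioi x, ‖deriv f y‖ₑ := by
  have h := h2f.integral_Ioi_deriv_eq hf x
  rw [← enorm_neg, ← h]
  exact enorm_integral_le_lintegral_enorm _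

lemma enorm_le_all {f : ℝ → ℝ} (hf : ContDiff ℝ 1 f) (h2f : HasCompactSupport f) (x : ℝ) :
    ‖f x‖ₑ ≤ ∫⁻ y, ‖deriv f y‖ₑ :=
  (enorm_le_Ioi hf h2f x).trans (setLIntegral_le_lintegral _ _)

/-- line bounds -/
lemma line_x {N : ℕ} {v : (Fin N → ℝ) × ℝ → ℝ} (hv : ContDiff ℝ 1 v) (h2v : HasCompactSupport v)
    (x : Fin N → ℝ) (y : ℝ) (i : Fin N) :
    ‖v (x, y)‖ₑ ≤ ∫⁻ t, ‖fderiv ℝ v (Function.update x i t, y) (Pi.single i 1, 0)‖ₑ := by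
  have hd : ∀ t, HasDerivAt (fun t => (Function.update x i t, y))
      ((Pi.single i 1, 0) : (Fin N → ℝ) × ℝ) t := fun t =>
    (hasDerivAt_update x i t).prodMk (hasDerivAt_const t y)
  have hcl : Topology.IsClosedEmbedding (fun t : ℝ => (Function.update x i t, y)) := by
    refine Topology.IsClosedEmbedding.of_continuous_injective_isClosedMap ?_ ?_ ?_
    · fun_prop
    · intro a b hab
      have := congrFun (congrArg Prod.fst hab) i
      simpa using this
    · have := (isClosedEmbedding_update x i).isClosedMap
      intro s hs
      have h1 : (fun t : ℝ => (Function.update x i t, y)) '' s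
          = (Function.update x i '' s) ×ˢ {y} := by
        ext ⟨a, b⟩
        simp only [Set.mem_image, Set.mem_prod, Prod.mk.injEq, Set.mem_singleton_iff]
        constructor
        · rintro ⟨t, ht, h1, h2⟩; exact ⟨⟨t, ht, h1⟩, h2.symm⟩
        · rintro ⟨⟨t, ht, h1⟩, h2⟩; exact ⟨t, ht, h1, h2.symm⟩
      rw [h1]
      exact (this s hs).prod isClosed_singleton
  have hc : ContDiff ℝ 1 (fun t : ℝ => v (Function.update x i t, y)) :=
    hv.comp ((contDiff_update 1 x i).prodMk contDiff_const)
  have h := enorm_le_all hc (h2v.comp_isClosedEmbedding hcl) (x i)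
  simp only [Function.update_eq_self] at h
  refine h.trans (le_of_eq ?_)
  refine lintegral_congr fun t => ?_
  have := ((hv.differentiable one_ne_zero).differentiableAt.hasFDerivAt).comp_hasDerivAt t (hd t)
  rw [← this.deriv]
  rfl

lemma line_y {N : ℕ} {v : (Fin N → ℝ) × ℝ → ℝ} (hv : ContDiff ℝ 1 v) (h2v : HasCompactSupport v)
    (x : Fin N → ℝ) (y : ℝ) :
    ‖v (x, y)‖ₑ ≤ ∫⁻ t in Set.Ioi y, ‖fderiv ℝ v (x, t) (0, 1)‖ₑ := by
  have hd : ∀ t, HasDerivAt (fun t => (x, t))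
      ((0, 1) : (Fin N → ℝ) × ℝ) t := fun t =>
    (hasDerivAt_const t x).prodMk (hasDerivAt_id t)
  have hcl : Topology.IsClosedEmbedding (fun t : ℝ => (x, t)) := by
    refine Topology.IsClosedEmbedding.of_continuous_injective_isClosedMap ?_ ?_ ?_
    · fun_prop
    · intro a b hab
      exact congrArg Prod.snd hab
    · intro s hs
      have h1 : (fun t : ℝ => (x, t)) '' s = {x} ×ˢ s := by
        rw [Set.singleton_prod]
      rw [h1]
      exact isClosed_singleton.prod hs
  have hc : ContDiff ℝ 1 (fun t : ℝ => v (x, t)) :=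
    hv.comp (contDiff_const.prodMk contDiff_id)
  have h := enorm_le_Ioi hc (h2v.comp_isClosedEmbedding hcl) y
  refine h.trans (le_of_eq ?_)
  refine lintegral_congr fun t => ?_
  have := ((hv.differentiable one_ne_zero).differentiableAt.hasFDerivAt).comp_hasDerivAt t (hd t)
  rw [← this.deriv]
  rfl

/-- the weight -/
def rho (c : ℝ) (y : ℝ) : ℝ≥0∞ := ENNReal.ofReal ((min 1 y) ^ c)

lemma rho_meas (c : ℝ) : Measurable (rho c) := by
  unfold rho
  fun_prop

/-- the base measure -/
def hsM (N : ℕ) : Measure ((Fin N → ℝ) × ℝ) :=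
  (volume : Measure (Fin N → ℝ)).prod (volume.restrict (Set.Ioi 0))

lemma hsM_eq (N : ℕ) : volume.restrict (HS N) = hsM N := by
  have : HS N = Set.univ ×ˢ Set.Ioi 0 := by
    ext z; simp [HS]
  rw [this, Measure.volume_eq_prod, ← Measure.prod_restrict, Measure.restrict_univ, hsM]

lemma hsM_ae (N : ℕ) : ∀ᵐ z ∂(hsM N), 0 < z.2 := by
  rw [← hsM_eq]
  have : MeasurableSet (HS N) := measurableSet_lt measurable_const measurable_snd
  exact ae_restrict_mem this

/-- L¹ Sobolev for `c ≤ 0`. -/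
lemma sob_neg (N : ℕ) (hN : 1 ≤ N) (c : ℝ) (hc : c ≤ 0)
    (v : (Fin N → ℝ) × ℝ → ℝ) (hv : ContDiff ℝ 1 v) (h2v : HasCompactSupport v)
    (G : (Fin N → ℝ) × ℝ → ℝ≥0∞) (hG : Measurable G)
    (hGx : ∀ z i, ‖fderiv ℝ v z (Pi.single i 1, 0)‖ₑ ≤ G z)
    (hGy : ∀ z, ‖fderiv ℝ v z (0, 1)‖ₑ ≤ G z) :
    ∫⁻ z, ‖v z‖ₑ ^ (((N : ℝ) + 1) / N) * rho c z.2 ∂(hsM N)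
      ≤ (∫⁻ z, G z * rho c z.2 ∂(hsM N)) ^ (((N : ℝ) + 1) / N) := by
  set ν : Measure ℝ := (volume.restrict (Set.Ioi 0)).withDensity (rho c) with hν
  have : SigmaFinite ν :=
    SigmaFinite.withDensity_of_ne_top (Filter.Eventually.of_forall fun _ => ENNReal.ofReal_ne_top)
  have hprod : ∀ f : (Fin N → ℝ) × ℝ → ℝ≥0∞, Measurable f →
      ∫⁻ z, f z ∂((volume : Measure (Fin N → ℝ)).prod ν) = ∫⁻ z, f z * rho c z.2 ∂(hsM N) := by
    intro f hf
    rw [lintegral_prod _ hf.aemeasurable, hsM, lintegral_prod]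
    · refine lintegral_congr fun x => ?_
      rw [hν, lintegral_withDensity_eq_lintegral_mul _ (rho_meas c) (by fun_prop)]
      simp [mul_comm]
    · exact (hf.mul ((rho_meas c).comp measurable_snd)).aemeasurable
  have hvm : Measurable fun z => ‖v z‖ₑ := hv.continuous.measurable.enorm
  rw [← hprod G hG, ← hprod _ (hvm.pow_const _)]
  have hrho : ∀ t ∈ Set.Ioi (0 : ℝ), 1 ≤ rho c t := by
    intro t ht
    unfold rho
    rw [← ENNReal.ofReal_one]
    refine ENNReal.ofReal_le_ofReal ?_
    exact Real.one_le_rpow_of_pos_of_le_one_of_nonpos (lt_min one_pos ht) (min_le_left _ _) hc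
  have hS : MeasurableSet {z : (Fin N → ℝ) × ℝ | 0 < z.2} :=
    measurableSet_lt measurable_const measurable_snd
  have h := grid N hN ν ({z | 0 < z.2}.indicator fun z => ‖v z‖ₑ) G (hvm.indicator hS) hG ?_ ?_
  · refine le_trans (le_of_eq ?_) h
    have hz : ∀ᵐ z ∂((volume : Measure (Fin N → ℝ)).prod ν), 0 < z.2 := by
      have h1 : ∀ᵐ y ∂ν, 0 < y := by
        refine (withDensity_absolutelyContinuous _ _).ae_le ?_
        exact ae_restrict_mem measurableSet_Ioi
      exact Measure.quasiMeasurePreserving_snd.ae h1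
    refine lintegral_congr_ae ?_
    filter_upwards [hz] with z hz
    simp [Set.indicator, hz]
  · intro x y i
    refine (Set.indicator_le_self _ _ _).trans ?_
    exact (line_x hv h2v x y i).trans (lintegral_mono fun t => hGx _ _)
  · intro x y
    by_cases hy : 0 < y
    · refine (Set.indicator_le_self _ _ _).trans ((line_y hv h2v x y).trans ?_)
      rw [hν, lintegral_withDensity_eq_lintegral_mul _ (rho_meas c) (by fun_prop)]
      refine le_trans (lintegral_mono_set (t := Set.Ioi 0) fun t ht => lt_trans hy ht) ?_
      refine setLIntegral_mono' measurableSet_Ioi fun t ht => ?_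
      calc _ ≤ 1 * G (x, t) := by rw [one_mul]; exact hGy _
        _ ≤ _ := by simp only [Pi.mul_apply]; gcongr; exact hrho t ht
    · simp [Set.indicator, hy]

lemma rho_ne_top (c y : ℝ) : rho c y ≠ ⊤ := ENNReal.ofReal_ne_top

/-- Hardy weight -/
def hW (c : ℝ) (y : ℝ) : ℝ≥0∞ :=
  (Set.Ioo (0 : ℝ) 1).indicator (fun y => ENNReal.ofReal (y ^ (c - 1))) y

lemma hW_meas (c : ℝ) : Measurable (hW c) := by
  unfold hW
  exact Measurable.indicator (by fun_prop) measurableSet_Ioo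

lemma hW_int (c : ℝ) (hc : 0 < c) (t : ℝ) (ht : 0 < t) :
    ∫⁻ y in Set.Ioi 0, (Set.Iio t).indicator (hW c) y ≤ ENNReal.ofReal (1 / c) * rho c t := by
  have hm : 0 < min 1 t := lt_min one_pos ht
  have h1 : ∫⁻ y in Set.Ioi 0, (Set.Iio t).indicator (hW c) y
      ≤ ∫⁻ y in Set.Ioc 0 (min 1 t), ENNReal.ofReal (y ^ (c - 1)) := by
    rw [← lintegral_indicator measurableSet_Ioi, ← lintegral_indicator measurableSet_Ioc]
    refine lintegral_mono fun y => ?_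
    simp only [Set.indicator, hW, Set.mem_Ioi, Set.mem_Iio, Set.mem_Ioo, Set.mem_Ioc, le_min_iff]
    split_ifs with h1 h2 h3 h4 h4 <;> try simp
    exact absurd ⟨h1, h3.2.le, h2.le⟩ h4
  refine h1.trans (le_of_eq ?_)
  have hi : IntervalIntegrable (fun y : ℝ => y ^ (c - 1)) volume 0 (min 1 t) :=
    intervalIntegral.intervalIntegrable_rpow' (by linarith)
  rw [intervalIntegrable_iff_integrableOn_Ioc_of_le hm.le] at hi
  rw [← ofReal_integral_eq_lintegral_ofReal hi, ← intervalIntegral.integral_of_le hm.le,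
    integral_rpow (Or.inl (by linarith)), rho, ← ENNReal.ofReal_mul (by positivity)]
  · congr 1
    rw [sub_add_cancel, Real.zero_rpow hc.ne']
    ring
  · filter_upwards [ae_restrict_mem measurableSet_Ioc] with y hy
    exact Real.rpow_nonneg hy.1.le _

lemma hardy (N : ℕ) (c : ℝ) (hc : 0 < c)
    (v : (Fin N → ℝ) × ℝ → ℝ) (hv : ContDiff ℝ 1 v) (h2v : HasCompactSupport v)
    (G : (Fin N → ℝ) × ℝ → ℝ≥0∞) (hG : Measurable G)
    (hGy : ∀ z, ‖fderiv ℝ v z (0, 1)‖ₑ ≤ G z) :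
    ∫⁻ z, ‖v z‖ₑ * hW c z.2 ∂(hsM N)
      ≤ ENNReal.ofReal (1 / c) * ∫⁻ z, G z * rho c z.2 ∂(hsM N) := by
  have hvm : Measurable fun z => ‖v z‖ₑ := hv.continuous.measurable.enorm
  have hWm := hW_meas c
  have hrm := rho_meas c
  have hm1 : Measurable fun z : (Fin N → ℝ) × ℝ => ‖v z‖ₑ * hW c z.2 :=
    hvm.mul (hWm.comp measurable_snd)
  have hm2 : Measurable fun z : (Fin N → ℝ) × ℝ => G z * rho c z.2 :=
    hG.mul (hrm.comp measurable_snd)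
  rw [hsM, lintegral_prod _ hm1.aemeasurable, lintegral_prod _ hm2.aemeasurable,
    ← lintegral_const_mul' _ _ ENNReal.ofReal_ne_top]
  refine lintegral_mono fun x => ?_
  have hGx : Measurable fun t => G (x, t) := hG.comp (by fun_prop)
  have hlt : MeasurableSet {p : ℝ × ℝ | p.1 < p.2} :=
    measurableSet_lt measurable_fst measurable_snd
  calc ∫⁻ y in Set.Ioi 0, ‖v (x, y)‖ₑ * hW c y
      ≤ ∫⁻ y in Set.Ioi 0, ∫⁻ t in Set.Ioi 0,
          {p : ℝ × ℝ | p.1 < p.2}.indicator (fun p => G (x, p.2) * hW c p.1) (y, t) := by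
        refine setLIntegral_mono' measurableSet_Ioi fun y hy => ?_
        have h1 : ‖v (x, y)‖ₑ ≤ ∫⁻ t in Set.Ioi y, G (x, t) :=
          (line_y hv h2v x y).trans (lintegral_mono fun t => hGy _)
        refine (mul_le_mul_left h1 (hW c y)).trans ?_
        rw [← lintegral_mul_const _ hGx, ← lintegral_indicator measurableSet_Ioi,
          ← lintegral_indicator measurableSet_Ioi]
        refine lintegral_mono fun t => ?_
        simp only [Set.indicator, Set.mem_Ioi, Set.mem_ofPred_eq]
        have hy' : 0 < y := hy
        split_ifs with h1 h2 <;> try simp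
        exact absurd (hy'.trans h1) h2
    _ = ∫⁻ t in Set.Ioi 0, ∫⁻ y in Set.Ioi 0,
          {p : ℝ × ℝ | p.1 < p.2}.indicator (fun p => G (x, p.2) * hW c p.1) (y, t) := by
        refine lintegral_lintegral_swap ?_
        refine Measurable.aemeasurable ?_
        exact ((hGx.comp measurable_snd).mul (hWm.comp measurable_fst)).indicator hlt
    _ ≤ ∫⁻ t in Set.Ioi 0, ENNReal.ofReal (1 / c) * (G (x, t) * rho c t) := by
        refine setLIntegral_mono' measurableSet_Ioi fun t ht => ?_
        have h1 : ∀ y, {p : ℝ × ℝ | p.1 < p.2}.indicator (fun p => G (x, p.2) * hW c p.1) (y, t)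
            = G (x, t) * (Set.Iio t).indicator (hW c) y := by
          intro y
          simp only [Set.indicator, Set.mem_Iio, Set.mem_ofPred_eq]
          split_ifs <;> simp
        simp_rw [h1]
        rw [lintegral_const_mul _ (hWm.indicator measurableSet_Iio)]
        refine (mul_le_mul_right (hW_int c hc t ht) _).trans (le_of_eq ?_)
        ring
    _ = ENNReal.ofReal (1 / c) * ∫⁻ t in Set.Ioi 0, G (x, t) * rho c t :=
        lintegral_const_mul' _ _ ENNReal.ofReal_ne_top

lemma sob_pos_grid (N : ℕ) (hN : 1 ≤ N) (c : ℝ) (hc : 0 ≤ c)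
    (v : (Fin N → ℝ) × ℝ → ℝ) (hv : ContDiff ℝ 1 v) (h2v : HasCompactSupport v)
    (G : (Fin N → ℝ) × ℝ → ℝ≥0∞) (hG : Measurable G)
    (hGx : ∀ z i, ‖fderiv ℝ v z (Pi.single i 1, 0)‖ₑ ≤ G z)
    (hGy : ∀ z, ‖fderiv ℝ v z (0, 1)‖ₑ ≤ G z) :
    ∫⁻ z, (‖v z‖ₑ * rho c z.2) ^ (((N : ℝ) + 1) / N) ∂(hsM N)
      ≤ (∫⁻ z, G z * rho c z.2 ∂(hsM N)) ^ (((N : ℝ) + 1) / N) := by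
  have hvm : Measurable fun z => ‖v z‖ₑ := hv.continuous.measurable.enorm
  have hrm := rho_meas c
  have hm1 : Measurable fun z : (Fin N → ℝ) × ℝ => ‖v z‖ₑ * rho c z.2 :=
    hvm.mul (hrm.comp measurable_snd)
  have hm2 : Measurable fun z : (Fin N → ℝ) × ℝ => G z * rho c z.2 :=
    hG.mul (hrm.comp measurable_snd)
  have hS : MeasurableSet {z : (Fin N → ℝ) × ℝ | 0 < z.2} :=
    measurableSet_lt measurable_const measurable_snd
  have h := grid N hN (volume.restrict (Set.Ioi 0))
    ({z | 0 < z.2}.indicator fun z => ‖v z‖ₑ * rho c z.2)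
    (fun z => G z * rho c z.2) (hm1.indicator hS) hm2 ?_ ?_
  · refine le_trans (le_of_eq ?_) h
    refine lintegral_congr_ae ?_
    filter_upwards [hsM_ae N] with z hz
    simp [Set.indicator, hz]
  · intro x y i
    refine (Set.indicator_le_self _ _ _).trans ?_
    simp only
    rw [lintegral_mul_const' _ _ (rho_ne_top c y)]
    gcongr
    exact (line_x hv h2v x y i).trans (lintegral_mono fun t => hGx _ _)
  · intro x y
    by_cases hy : 0 < y
    · refine (Set.indicator_le_self _ _ _).trans ?_
      refine (mul_le_mul_left (line_y hv h2v x y) _).trans ?_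
      rw [← lintegral_mul_const' _ _ (rho_ne_top c _)]
      refine le_trans ?_ (lintegral_mono_set (s := Set.Ioi y) fun t ht => lt_trans hy ht)
      refine setLIntegral_mono' measurableSet_Ioi fun t ht => ?_
      refine mul_le_mul' (hGy _) ?_
      refine ENNReal.ofReal_le_ofReal ?_
      have hyt : y < t := ht
      exact Real.rpow_le_rpow (le_min zero_le_one hy.le) (min_le_min_left _ hyt.le) hc
    · simp [Set.indicator, hy]

/-- L¹ Sobolev for `c > 0`. -/
lemma sob_pos (N : ℕ) (hN : 1 ≤ N) (c : ℝ) (hc : 0 < c)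
    (v : (Fin N → ℝ) × ℝ → ℝ) (hv : ContDiff ℝ 1 v) (h2v : HasCompactSupport v)
    (G : (Fin N → ℝ) × ℝ → ℝ≥0∞) (hG : Measurable G)
    (hGx : ∀ z i, ‖fderiv ℝ v z (Pi.single i 1, 0)‖ₑ ≤ G z)
    (hGy : ∀ z, ‖fderiv ℝ v z (0, 1)‖ₑ ≤ G z) :
    ∫⁻ z, ‖v z‖ₑ ^ (((N : ℝ) + 1 + c) / (N + c)) * rho c z.2 ∂(hsM N)
      ≤ (ENNReal.ofReal (1 / c) + 1) ^ (c / (N + c)) *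
        (∫⁻ z, (G z + ‖v z‖ₑ) * rho c z.2 ∂(hsM N)) ^ (((N : ℝ) + 1 + c) / (N + c)) := by
  have hN' : (0 : ℝ) < N := by exact_mod_cast hN
  have hvm : Measurable fun z => ‖v z‖ₑ := hv.continuous.measurable.enorm
  have hrm := rho_meas c
  have hWm := hW_meas c
  set B := ∫⁻ z, (G z + ‖v z‖ₑ) * rho c z.2 ∂(hsM N) with hB
  have hGB : ∫⁻ z, G z * rho c z.2 ∂(hsM N) ≤ B := by
    refine lintegral_mono fun z => ?_
    gcongr
    exact le_self_add
  have hvB : ∫⁻ z, ‖v z‖ₑ * rho c z.2 ∂(hsM N) ≤ B := by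
    refine lintegral_mono fun z => ?_
    gcongr
    exact le_add_self
  have h1 := (sob_pos_grid N hN c hc.le v hv h2v G hG hGx hGy).trans
    (ENNReal.rpow_le_rpow hGB (by positivity))
  have h2 : ∫⁻ z, ‖v z‖ₑ * (hW c z.2 + rho c z.2) ∂(hsM N) ≤ (ENNReal.ofReal (1 / c) + 1) * B := by
    simp_rw [mul_add]
    have hm0 : Measurable fun z : (Fin N → ℝ) × ℝ => ‖v z‖ₑ * hW c z.2 :=
      hvm.mul (hWm.comp measurable_snd)
    rw [lintegral_add_left hm0, add_mul, one_mul]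
    exact add_le_add ((hardy N c hc v hv h2v G hG hGy).trans (mul_le_mul_right hGB _)) hvB
  have hm1 : Measurable fun z : (Fin N → ℝ) × ℝ => (‖v z‖ₑ * rho c z.2) ^ (((N : ℝ) + 1) / N) :=
    (hvm.mul (hrm.comp measurable_snd)).pow_const _
  have hm2 : Measurable fun z : (Fin N → ℝ) × ℝ => ‖v z‖ₑ * (hW c z.2 + rho c z.2) :=
    hvm.mul ((hWm.comp measurable_snd).add (hrm.comp measurable_snd))
  have hl1 : 0 ≤ (N : ℝ) / (N + c) := by positivity
  have hl2 : 0 ≤ c / (N + c) := by positivity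
  calc ∫⁻ z, ‖v z‖ₑ ^ (((N : ℝ) + 1 + c) / (N + c)) * rho c z.2 ∂(hsM N)
      ≤ ∫⁻ z, ((‖v z‖ₑ * rho c z.2) ^ (((N : ℝ) + 1) / N)) ^ ((N : ℝ) / (N + c)) *
          (‖v z‖ₑ * (hW c z.2 + rho c z.2)) ^ (c / (N + c)) ∂(hsM N) := by
        refine lintegral_mono_ae ?_
        filter_upwards [hsM_ae N] with z hz
        have hm : 0 < min 1 z.2 := lt_min one_pos hz
        have hw : ENNReal.ofReal ((min 1 z.2) ^ (c - 1)) ≤ hW c z.2 + rho c z.2 := by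
          by_cases h : z.2 < 1
          · refine le_trans (le_of_eq ?_) le_self_add
            simp [hW, h, hz, min_eq_right h.le]
          · refine le_trans (le_of_eq ?_) le_add_self
            simp [rho, min_eq_left (not_lt.1 h)]
        refine le_trans (le_of_eq ?_)
          (mul_le_mul_right (ENNReal.rpow_le_rpow (mul_le_mul_right hw _) hl2) _)
        rw [rho, ← ENNReal.rpow_mul, ENNReal.mul_rpow_of_nonneg _ _ (by positivity),
          ENNReal.mul_rpow_of_nonneg _ _ hl2,
          ENNReal.ofReal_rpow_of_nonneg (by positivity) (by positivity),
          ENNReal.ofReal_rpow_of_nonneg (by positivity) (by positivity),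
          ← Real.rpow_mul hm.le, ← Real.rpow_mul hm.le, mul_mul_mul_comm,
          ← ENNReal.rpow_add_of_nonneg _ _ (by positivity) hl2,
          ← ENNReal.ofReal_mul (by positivity), ← Real.rpow_add hm]
        congr 2
        · field_simp
        · congr 1
          field_simp
          ring
    _ ≤ (∫⁻ z, (‖v z‖ₑ * rho c z.2) ^ (((N : ℝ) + 1) / N) ∂(hsM N)) ^ ((N : ℝ) / (N + c)) *
          (∫⁻ z, ‖v z‖ₑ * (hW c z.2 + rho c z.2) ∂(hsM N)) ^ (c / (N + c)) := by
        refine ENNReal.lintegral_mul_norm_pow_le hm1.aemeasurable hm2.aemeasurable hl1 hl2 ?_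
        field_simp
    _ ≤ (B ^ (((N : ℝ) + 1) / N)) ^ ((N : ℝ) / (N + c)) *
          ((ENNReal.ofReal (1 / c) + 1) * B) ^ (c / (N + c)) := by
        gcongr
    _ = _ := by
        rw [← ENNReal.rpow_mul, ENNReal.mul_rpow_of_nonneg _ _ hl2, mul_left_comm,
          ← ENNReal.rpow_add_of_nonneg _ _ (by positivity) hl2]
        congr 2
        field_simp

/-- L¹ Sobolev. -/
lemma sob (N : ℕ) (hN : 1 ≤ N) (c : ℝ) :
    ∃ K : ℝ≥0∞, K ≠ ⊤ ∧ ∀ (v : (Fin N → ℝ) × ℝ → ℝ), ContDiff ℝ 1 v → HasCompactSupport v →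
    ∀ (G : (Fin N → ℝ) × ℝ → ℝ≥0∞), Measurable G →
    (∀ z i, ‖fderiv ℝ v z (Pi.single i 1, 0)‖ₑ ≤ G z) →
    (∀ z, ‖fderiv ℝ v z (0, 1)‖ₑ ≤ G z) →
    ∫⁻ z, ‖v z‖ₑ ^ (((N : ℝ) + 1 + max c 0) / (((N : ℝ) + 1 + max c 0) - 1)) * rho c z.2 ∂(hsM N)
      ≤ K * (∫⁻ z, (G z + ‖v z‖ₑ) * rho c z.2 ∂(hsM N)) ^
        (((N : ℝ) + 1 + max c 0) / (((N : ℝ) + 1 + max c 0) - 1)) := by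
  have hN' : (0 : ℝ) < N := by exact_mod_cast hN
  rcases le_or_gt c 0 with hc | hc
  · refine ⟨1, ENNReal.one_ne_top, ?_⟩
    intro v hv h2v G hG hGx hGy
    have h := sob_neg N hN c hc v hv h2v G hG hGx hGy
    have e : ((N : ℝ) + 1 + max c 0) / (((N : ℝ) + 1 + max c 0) - 1) = ((N : ℝ) + 1) / N := by
      rw [max_eq_right hc]; simp
    rw [e, one_mul]
    refine h.trans (ENNReal.rpow_le_rpow ?_ (by positivity))
    refine lintegral_mono fun z => ?_
    gcongr
    exact le_self_add
  · refine ⟨(ENNReal.ofReal (1 / c) + 1) ^ (c / (N + c)), ?_, ?_⟩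
    · exact ENNReal.rpow_ne_top_of_nonneg (by positivity) (by simp)
    intro v hv h2v G hG hGx hGy
    have h := sob_pos N hN c hc v hv h2v G hG hGx hGy
    have e : ((N : ℝ) + 1 + max c 0) / (((N : ℝ) + 1 + max c 0) - 1)
        = ((N : ℝ) + 1 + c) / (N + c) := by
      rw [max_eq_left hc.le]; congr 1; ring
    rw [e]
    exact h

lemma interp {α : Type*} [MeasurableSpace α] (m : Measure α) (f w : α → ℝ≥0∞)
    (hf : Measurable f) (hw : Measurable w) (r Q : ℝ) (hQ : 2 < Q) (h2 : 2 ≤ r) (hr : r ≤ Q) :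
    ∫⁻ z, f z ^ r * w z ∂m ≤ (∫⁻ z, f z ^ (2 : ℝ) * w z ∂m) ^ ((Q - r) / (Q - 2)) *
      (∫⁻ z, f z ^ Q * w z ∂m) ^ ((r - 2) / (Q - 2)) := by
  have h0 : 0 < Q - 2 := by linarith
  have ha : 0 ≤ (Q - r) / (Q - 2) := div_nonneg (by linarith) h0.le
  have hb : 0 ≤ (r - 2) / (Q - 2) := div_nonneg (by linarith) h0.le
  have hab : (Q - r) / (Q - 2) + (r - 2) / (Q - 2) = 1 := by field_simp; ring
  refine le_trans (le_of_eq ?_) (ENNReal.lintegral_mul_norm_pow_le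
    ((hf.pow_const _).mul hw).aemeasurable ((hf.pow_const _).mul hw).aemeasurable ha hb hab)
  refine lintegral_congr fun z => ?_
  simp only [Pi.mul_apply]
  rw [ENNReal.mul_rpow_of_nonneg _ _ ha, ENNReal.mul_rpow_of_nonneg _ _ hb, mul_mul_mul_comm,
    ← ENNReal.rpow_add_of_nonneg _ _ ha hb, hab, ENNReal.rpow_one, ← ENNReal.rpow_mul,
    ← ENNReal.rpow_mul, ← ENNReal.rpow_add_of_nonneg _ _ (by positivity) (by positivity)]
  congr 2
  field_simp
  ring

lemma cs {α : Type*} [MeasurableSpace α] (m : Measure α) (f g w : α → ℝ≥0∞)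
    (hf : Measurable f) (hg : Measurable g) (hw : Measurable w) :
    ∫⁻ z, f z * g z * w z ∂m ≤ (∫⁻ z, f z ^ (2 : ℝ) * w z ∂m) ^ (1 / 2 : ℝ) *
      (∫⁻ z, g z ^ (2 : ℝ) * w z ∂m) ^ (1 / 2 : ℝ) := by
  refine le_trans (le_of_eq ?_) (ENNReal.lintegral_mul_norm_pow_le
    ((hf.pow_const _).mul hw).aemeasurable ((hg.pow_const _).mul hw).aemeasurable
    (by norm_num) (by norm_num) (by norm_num))
  refine lintegral_congr fun z => ?_
  simp only [Pi.mul_apply]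
  rw [ENNReal.mul_rpow_of_nonneg _ _ (by norm_num), ENNReal.mul_rpow_of_nonneg _ _ (by norm_num),
    mul_mul_mul_comm, ← ENNReal.rpow_add_of_nonneg _ _ (by norm_num) (by norm_num),
    ← ENNReal.rpow_mul, ← ENNReal.rpow_mul]
  norm_num

lemma deriv_pow_bound {E : Type*} [NormedAddCommGroup E] [NormedSpace ℝ E] (u : E → ℂ)
    (hu : Differentiable ℝ u) (s : ℝ) (hs : 2 ≤ s) (z e : E) :
    ‖fderiv ℝ (fun z => ‖u z‖ ^ s) z e‖ ≤ s * ‖u z‖ ^ (s - 1) * ‖fderiv ℝ u z e‖ := by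
  rw [hu.fderiv_norm_rpow (by linarith)]
  simp only [smul_apply, ContinuousLinearMap.comp_apply, innerSL_apply_apply,
    norm_smul, norm_mul]
  have h1 : ‖u z‖ ^ (s - 2) * ‖u z‖ = ‖u z‖ ^ (s - 1) := by
    rcases (norm_nonneg (u z)).eq_or_lt with h | h
    · rw [← h, Real.zero_rpow (by linarith : s - 1 ≠ 0), mul_zero]
    · rw [← Real.rpow_add_one h.ne']; congr 1; ring
  rw [Real.norm_of_nonneg (by linarith : (0 : ℝ) ≤ s),
    Real.norm_of_nonneg (Real.rpow_nonneg (norm_nonneg (u z)) _), ← h1]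
  calc s * ‖u z‖ ^ (s - 2) * ‖inner ℝ (u z) (fderiv ℝ u z e)‖
      ≤ s * ‖u z‖ ^ (s - 2) * (‖u z‖ * ‖fderiv ℝ u z e‖) := by
        gcongr
        exact norm_inner_le_norm _ _
    _ = _ := by ring

lemma gradSqC_cont {N : ℕ} (u : ((Fin N → ℝ) × ℝ) → ℂ) (hu : ContDiff ℝ 1 u) :
    Continuous (gradSqC u) := by
  have h : Continuous (fderiv ℝ u) := hu.continuous_fderiv one_ne_zero
  unfold gradSqC pXc pYc
  fun_prop

lemma gradSqC_nonneg {N : ℕ} (u : ((Fin N → ℝ) × ℝ) → ℂ) (z) : 0 ≤ gradSqC u z := by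
  unfold gradSqC
  positivity

lemma gradSqC_supp {N : ℕ} (u : ((Fin N → ℝ) × ℝ) → ℂ) (hu : HasCompactSupport u) :
    HasCompactSupport (gradSqC u) := by
  refine (hu.fderiv (𝕜 := ℝ)).mono ?_
  intro z hz h
  apply hz
  simp [gradSqC, pXc, pYc, h]

/-- the main differential inequality -/
lemma mainIneq (N : ℕ) (c : ℝ) (p s : ℝ) (hs : 2 ≤ s) (K : ℝ≥0∞) (hp : 0 ≤ p)
    (hK : ∀ (v : (Fin N → ℝ) × ℝ → ℝ), ContDiff ℝ 1 v → HasCompactSupport v →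
    ∀ (G : (Fin N → ℝ) × ℝ → ℝ≥0∞), Measurable G →
    (∀ z i, ‖fderiv ℝ v z (Pi.single i 1, 0)‖ₑ ≤ G z) →
    (∀ z, ‖fderiv ℝ v z (0, 1)‖ₑ ≤ G z) →
    ∫⁻ z, ‖v z‖ₑ ^ p * rho c z.2 ∂(hsM N)
      ≤ K * (∫⁻ z, (G z + ‖v z‖ₑ) * rho c z.2 ∂(hsM N)) ^ p)
    (u : ((Fin N → ℝ) × ℝ) → ℂ) (hu : ContDiff ℝ 1 u) (h2u : HasCompactSupport u) :
    ∫⁻ z, ‖u z‖ₑ ^ (s * p) * rho c z.2 ∂(hsM N) ≤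
      K * (ENNReal.ofReal s * ((∫⁻ z, ‖u z‖ₑ ^ (2 * s - 2) * rho c z.2 ∂(hsM N)) ^ (1 / 2 : ℝ) *
        ((∫⁻ z, ‖u z‖ₑ ^ (2 : ℝ) * rho c z.2 ∂(hsM N)) ^ (1 / 2 : ℝ) +
        (∫⁻ z, ENNReal.ofReal (gradSqC u z) * rho c z.2 ∂(hsM N)) ^ (1 / 2 : ℝ)))) ^ p := by
  set g : (Fin N → ℝ) × ℝ → ℝ≥0∞ := fun z => ENNReal.ofReal (√(gradSqC u z)) with hg
  have hum : Measurable fun z => ‖u z‖ₑ := hu.continuous.measurable.enorm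
  have hgm : Measurable g := by
    have := (gradSqC_cont u hu).measurable
    exact (this.sqrt).ennreal_ofReal
  have hrm : Measurable fun z : (Fin N → ℝ) × ℝ => rho c z.2 := (rho_meas c).comp measurable_snd
  set G : (Fin N → ℝ) × ℝ → ℝ≥0∞ := fun z => ENNReal.ofReal s * (‖u z‖ₑ ^ (s - 1) * g z) with hG
  have hGm : Measurable G := ((hum.pow_const _).mul hgm).const_mul _
  have hbound : ∀ z e, ‖fderiv ℝ u z e‖ ≤ √(gradSqC u z) →
      ‖fderiv ℝ (fun z => ‖u z‖ ^ s) z e‖ₑ ≤ G z := by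
    intro z e h
    have h1 := deriv_pow_bound u (hu.differentiable one_ne_zero) s hs z e
    rw [← ofReal_norm, hG]
    simp only [hg]
    rw [← ofReal_norm (u z), ENNReal.ofReal_rpow_of_nonneg (norm_nonneg _) (by linarith),
      ← ENNReal.ofReal_mul (by positivity), ← ENNReal.ofReal_mul (by positivity)]
    refine ENNReal.ofReal_le_ofReal (h1.trans ?_)
    rw [mul_assoc]
    gcongr
  have key := hK (fun z => ‖u z‖ ^ s) ((contDiff_norm_rpow (by linarith)).comp hu) ?_ G hGm ?_ ?_
  rotate_left
  · refine h2u.mono ?_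
    intro z hz h
    apply hz
    simp only [h, norm_zero]
    exact Real.zero_rpow (by linarith)
  · intro z i
    refine hbound z _ (Real.le_sqrt_of_sq_le ?_)
    unfold gradSqC
    have := Finset.single_le_sum (f := fun i => ‖pXc u i z‖ ^ 2) (fun i _ => by positivity)
      (Finset.mem_univ i)
    have h2 : 0 ≤ ‖pYc u z‖ ^ 2 := by positivity
    exact this.trans (by linarith)
  · intro z
    refine hbound z _ (Real.le_sqrt_of_sq_le ?_)
    unfold gradSqC
    have h2 : 0 ≤ ∑ i, ‖pXc u i z‖ ^ 2 := by positivity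
    have h3 : ‖fderiv ℝ u z (0, 1)‖ ^ 2 = ‖pYc u z‖ ^ 2 := rfl
    linarith
  have hen : ∀ z, ‖(‖u z‖ ^ s : ℝ)‖ₑ = ‖u z‖ₑ ^ s := by
    intro z
    rw [← ofReal_norm, ← ofReal_norm (u z), ENNReal.ofReal_rpow_of_nonneg (norm_nonneg _)
      (by linarith), Real.norm_of_nonneg (by positivity)]
  simp_rw [hen, ← ENNReal.rpow_mul] at key
  refine key.trans ?_
  gcongr
  have hs1 : (1 : ℝ≥0∞) ≤ ENNReal.ofReal s := by
    rw [← ENNReal.ofReal_one]; exact ENNReal.ofReal_le_ofReal (by linarith)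
  have hsq : ∀ z, (‖u z‖ₑ ^ (s - 1)) ^ (2 : ℝ) = ‖u z‖ₑ ^ (2 * s - 2) := by
    intro z
    rw [← ENNReal.rpow_mul]; congr 1; ring
  have hgsq : ∀ z, g z ^ (2 : ℝ) = ENNReal.ofReal (gradSqC u z) := by
    intro z
    rw [hg]
    simp only
    rw [ENNReal.ofReal_rpow_of_nonneg (Real.sqrt_nonneg _) (by norm_num)]
    congr 1
    rw [show (2 : ℝ) = ((2 : ℕ) : ℝ) by norm_num, Real.rpow_natCast,
      Real.sq_sqrt (gradSqC_nonneg u z)]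
  have c1 := cs (hsM N) (fun z => ‖u z‖ₑ ^ (s - 1)) g (fun z => rho c z.2)
    (hum.pow_const _) hgm hrm
  have c2 := cs (hsM N) (fun z => ‖u z‖ₑ ^ (s - 1)) (fun z => ‖u z‖ₑ) (fun z => rho c z.2)
    (hum.pow_const _) hum hrm
  simp_rw [hsq] at c1 c2
  simp_rw [hgsq] at c1
  have hm1 : Measurable fun z => ‖u z‖ₑ ^ (s - 1) * ‖u z‖ₑ * rho c z.2 :=
    ((hum.pow_const _).mul hum).mul hrm
  calc ∫⁻ z, (G z + ‖u z‖ₑ ^ s) * rho c z.2 ∂(hsM N)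
      ≤ ∫⁻ z, ENNReal.ofReal s * (‖u z‖ₑ ^ (s - 1) * ‖u z‖ₑ * rho c z.2
          + ‖u z‖ₑ ^ (s - 1) * g z * rho c z.2) ∂(hsM N) := by
        refine lintegral_mono fun z => ?_
        have e : ‖u z‖ₑ ^ s = ‖u z‖ₑ ^ (s - 1) * ‖u z‖ₑ := by
          conv_rhs => rw [← ENNReal.rpow_one (‖u z‖ₑ), ← ENNReal.rpow_mul, one_mul]
          rw [← ENNReal.rpow_add_of_nonneg _ _ (by linarith) (by norm_num)]
          congr 1; ring
        simp only [e, hG]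
        rw [add_mul, mul_add, add_comm]
        refine add_le_add (le_mul_of_one_le_left' hs1) (le_of_eq ?_)
        ring
    _ = ENNReal.ofReal s * (∫⁻ z, ‖u z‖ₑ ^ (s - 1) * ‖u z‖ₑ * rho c z.2 ∂(hsM N)
          + ∫⁻ z, ‖u z‖ₑ ^ (s - 1) * g z * rho c z.2 ∂(hsM N)) := by
        rw [lintegral_const_mul' _ _ ENNReal.ofReal_ne_top, lintegral_add_left hm1]
    _ ≤ _ := by
        rw [mul_add ((∫⁻ z, ‖u z‖ₑ ^ (2 * s - 2) * rho c z.2 ∂(hsM N)) ^ (1 / 2 : ℝ))]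
        gcongr

lemma fin_int (N : ℕ) (c : ℝ) (hc : c + 1 > 0) (f : (Fin N → ℝ) × ℝ → ℝ) (hf : Continuous f)
    (h2f : HasCompactSupport f) :
    ∫⁻ z, ENNReal.ofReal (f z) * rho c z.2 ∂(hsM N) ≠ ⊤ := by
  obtain ⟨M, hM⟩ := h2f.exists_bound_of_continuous hf
  set K := tsupport f with hK
  have hKc : IsCompact K := h2f
  have hK1 : IsCompact (Prod.fst '' K) := hKc.image continuous_fst
  have hK2 : IsCompact (Prod.snd '' K) := hKc.image continuous_snd
  obtain ⟨R, hR⟩ := hK2.bddAbove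
  set R' := max R 0 with hR'
  have h1 : ∫⁻ z, ENNReal.ofReal (f z) * rho c z.2 ∂(hsM N) ≤
      ∫⁻ z, (Prod.fst '' K).indicator (fun _ => ENNReal.ofReal M) z.1 *
        (Set.Iic R').indicator (rho c) z.2 ∂(hsM N) := by
    refine lintegral_mono fun z => ?_
    by_cases hz : z ∈ K
    · have hz1 : z.1 ∈ Prod.fst '' K := ⟨z, hz, rfl⟩
      have hz2 : z.2 ∈ Set.Iic R' := (hR ⟨z, hz, rfl⟩).trans (le_max_left _ _)
      simp only [Set.indicator_of_mem hz1, Set.indicator_of_mem hz2]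
      gcongr
      exact (le_abs_self _).trans (hM z)
    · have : f z = 0 := image_eq_zero_of_notMem_tsupport hz
      simp [this]
  refine ne_top_of_le_ne_top ?_ h1
  rw [hsM, lintegral_prod_mul]
  · refine ENNReal.mul_ne_top ?_ ?_
    · rw [lintegral_indicator hK1.measurableSet, setLIntegral_const]
      exact ENNReal.mul_ne_top ENNReal.ofReal_ne_top hK1.measure_lt_top.ne
    · have hi : IntervalIntegrable (fun y : ℝ => y ^ c + 1) volume 0 R' :=
        (intervalIntegral.intervalIntegrable_rpow' (by linarith)).add intervalIntegrable_const
      rw [intervalIntegrable_iff_integrableOn_Ioc_of_le (le_max_right _ _)] at hi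
      have h3 : ∫⁻ y in Set.Ioi 0, (Set.Iic R').indicator (rho c) y
          ≤ ∫⁻ y in Set.Ioc 0 R', ENNReal.ofReal (y ^ c + 1) := by
        rw [← lintegral_indicator measurableSet_Ioi, ← lintegral_indicator measurableSet_Ioc]
        refine lintegral_mono fun y => ?_
        simp only [Set.indicator, Set.mem_Ioi, Set.mem_Iic, Set.mem_Ioc]
        by_cases h : 0 < y
        · by_cases h' : y ≤ R'
          · simp only [h, h', if_true, and_self]
            refine ENNReal.ofReal_le_ofReal ?_
            have := Real.rpow_pos_of_pos h c
            rcases le_total 1 y with h1 | h1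
            · rw [min_eq_left h1]; simp; linarith
            · rw [min_eq_right h1]; linarith
          · simp [h']
        · simp [h]
      refine ne_top_of_le_ne_top ?_ h3
      exact (hi.lintegral_lt_top).ne
  · exact (measurable_const.indicator hK1.measurableSet).aemeasurable
  · exact ((rho_meas c).indicator measurableSet_Iic).aemeasurable

lemma real_int (N : ℕ) (c : ℝ) (f : (Fin N → ℝ) × ℝ → ℝ) (hf : Continuous f) (h0 : ∀ z, 0 ≤ f z) :
    ∫ z in HS N, f z * (min 1 z.2) ^ c =
      (∫⁻ z, ENNReal.ofReal (f z) * rho c z.2 ∂(hsM N)).toReal := by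
  rw [hsM_eq, integral_eq_lintegral_of_nonneg_ae]
  · congr 1
    refine lintegral_congr fun z => ?_
    rw [ENNReal.ofReal_mul (h0 z), rho]
  · filter_upwards [hsM_ae N] with z hz
    exact mul_nonneg (h0 z) (Real.rpow_nonneg (le_min zero_le_one hz.le) _)
  · have h := hf.measurable
    refine Measurable.aestronglyMeasurable ?_
    fun_prop

lemma exists_Q (D q : ℝ) (hD : 2 ≤ D) (hq₁ : 2 < q) (hq₂ : 1 / q ≥ 1 / 2 - 1 / D) :
    ∃ Q, q ≤ Q ∧ 2 * D ≤ Q * (D - 1) ∧ Q * (D - 2) ≤ 2 * D := by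
  rcases hD.eq_or_lt with h | h
  · subst h
    refine ⟨max q 4, le_max_left _ _, ?_, ?_⟩
    · have := le_max_right q 4
      linarith
    · norm_num
  · have h0 : 0 < D - 2 := by linarith
    refine ⟨2 * D / (D - 2), ?_, ?_, ?_⟩
    · rw [le_div_iff₀ h0]
      have h1 : 1 / 2 - 1 / D = (D - 2) / (2 * D) := by field_simp
      rw [h1, ge_iff_le, div_le_div_iff₀ (by linarith) (by linarith)] at hq₂
      linarith
    · rw [div_mul_eq_mul_div, le_div_iff₀ h0]
      nlinarith
    · rw [div_mul_cancel₀ _ h0.ne']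

lemma log_alg (D Q q θ k α x xq L : ℝ) (hD : 2 ≤ D) (hq : 2 < q) (hqQ : q ≤ Q)
    (hθ : θ = D * (1 / 2 - 1 / q))
    (h1 : x ≤ k + D / (D - 1) * (1 / 2 *
      ((Q - (2 * (Q * (D - 1) / D) - 2)) / (Q - 2) * α
        + (2 * (Q * (D - 1) / D) - 2 - 2) / (Q - 2) * x) + L))
    (h2 : xq ≤ (Q - q) / (Q - 2) * α + (q - 2) / (Q - 2) * x) :
    1 / q * xq ≤ (q - 2) * (D - 1) * k / (2 * q) + θ * L + (1 - θ) * (1 / 2 * α) := by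
  have hQ : 0 < Q - 2 := by linarith
  have hD0 : 0 < D := by linarith
  have hD1 : 0 < D - 1 := by linarith
  have hq0 : 0 < q := by linarith
  have h3 : x ≤ ((D - 1) * (Q - 2) * k + (D + Q - D * Q / 2) * α + D * (Q - 2) * L) / 2 := by
    have e : k + D / (D - 1) * (1 / 2 *
      ((Q - (2 * (Q * (D - 1) / D) - 2)) / (Q - 2) * α
        + (2 * (Q * (D - 1) / D) - 2 - 2) / (Q - 2) * x) + L) =
        x + (((D - 1) * (Q - 2) * k + (D + Q - D * Q / 2) * α + D * (Q - 2) * L) - 2 * x)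
          / ((D - 1) * (Q - 2)) := by
      field_simp
      ring
    rw [e] at h1
    have h4 : 0 ≤ (((D - 1) * (Q - 2) * k + (D + Q - D * Q / 2) * α + D * (Q - 2) * L) - 2 * x)
          / ((D - 1) * (Q - 2)) := by linarith
    have h5 : 0 < (D - 1) * (Q - 2) := mul_pos hD1 hQ
    rw [le_div_iff₀ h5, zero_mul] at h4
    linarith
  have h6 : (q - 2) / (Q - 2) * x ≤ (q - 2) / (Q - 2) *
      (((D - 1) * (Q - 2) * k + (D + Q - D * Q / 2) * α + D * (Q - 2) * L) / 2) :=
    mul_le_mul_of_nonneg_left h3 (div_nonneg (by linarith) hQ.le)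
  have h7 : xq ≤ (Q - q) / (Q - 2) * α + (q - 2) / (Q - 2) *
      (((D - 1) * (Q - 2) * k + (D + Q - D * Q / 2) * α + D * (Q - 2) * L) / 2) := by linarith
  refine (mul_le_mul_of_nonneg_left h7 (by positivity : 0 ≤ 1 / q)).trans (le_of_eq ?_)
  rw [hθ]
  field_simp
  ring

lemma real_alg (D Q q θ K s : ℝ) (hD : 2 ≤ D) (hq : 2 < q) (hqQ : q ≤ Q)
    (hθ : θ = D * (1 / 2 - 1 / q)) (hK : 0 < K) (hs : 0 < s) (a X Xr Xq A : ℝ)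
    (ha : 0 < a) (hX : 0 ≤ X) (hXr : 0 ≤ Xr) (hXq : 0 ≤ Xq) (hA : 0 < A)
    (h1 : X ≤ K * (s * (Xr ^ (1 / 2 : ℝ) * A)) ^ (D / (D - 1)))
    (h2 : Xr ≤ a ^ ((Q - (2 * (Q * (D - 1) / D) - 2)) / (Q - 2)) *
      X ^ ((2 * (Q * (D - 1) / D) - 2 - 2) / (Q - 2)))
    (h3 : Xq ≤ a ^ ((Q - q) / (Q - 2)) * X ^ ((q - 2) / (Q - 2))) :
    Xq ^ (1 / q) ≤ Real.exp ((q - 2) * (D - 1) * (Real.log K + D / (D - 1) * Real.log s) / (2 * q))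
      * A ^ θ * (a ^ (1 / 2 : ℝ)) ^ (1 - θ) := by
  have hq0 : 0 < q := by linarith
  have hD1 : 0 < D - 1 := by linarith
  rcases hXq.eq_or_lt with h | hXq
  · rw [← h, Real.zero_rpow (by positivity)]
    positivity
  have hXp : 0 < X := by
    rcases hX.eq_or_lt with h | h
    · rw [← h, Real.zero_rpow (div_pos (by linarith) (by linarith)).ne', mul_zero] at h3
      linarith
    · exact h
  have h4 : X ≤ K * (s * ((a ^ ((Q - (2 * (Q * (D - 1) / D) - 2)) / (Q - 2)) *
      X ^ ((2 * (Q * (D - 1) / D) - 2 - 2) / (Q - 2))) ^ (1 / 2 : ℝ) * A)) ^ (D / (D - 1)) := by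
    refine h1.trans ?_
    gcongr
  have l1 := Real.log_le_log hXp h4
  have l3 := Real.log_le_log hXq h3
  rw [Real.log_mul (by positivity) (by positivity), Real.log_rpow ha, Real.log_rpow hXp] at l3
  rw [Real.log_mul (by positivity) (by positivity), Real.log_rpow (by positivity),
    Real.log_mul (by positivity) (by positivity), Real.log_mul (by positivity) (by positivity),
    Real.log_rpow (by positivity), Real.log_mul (by positivity) (by positivity),
    Real.log_rpow ha, Real.log_rpow hXp] at l1
  have := log_alg D Q q θ (Real.log K + D / (D - 1) * Real.log s) (Real.log a) (Real.log X)
    (Real.log Xq) (Real.log A) hD hq hqQ hθ (l1.trans (le_of_eq (by ring))) l3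
  rw [← Real.log_le_log_iff (by positivity) (by positivity), Real.log_rpow hXq,
    Real.log_mul (by positivity) (by positivity), Real.log_mul (by positivity) (by positivity),
    Real.log_exp, Real.log_rpow hA, Real.log_rpow (by positivity), Real.log_rpow ha]
  exact this

/-- Gagliardo–Nirenberg inequality for the measure
`dμ = (1 ∧ y)^c dx dy`: for `c + 1 > 0`, `q ∈ (2,∞)` with
`1/q ≥ 1/2 − 1/(N+1+c⁺)` and `θ = (N+1+c⁺)(1/2 − 1/q)`, one has
`‖u‖_{L^q_μ} ≤ C (‖u‖_μ + ‖∇u‖_μ)^θ ‖u‖_μ^{1−θ}` for every `u ∈ 𝒞`. -/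
theorem stmt_16 (N : ℕ) (hN : 1 ≤ N) (c : ℝ) (hc : c + 1 > 0)
    (q : ℝ) (hq₁ : 2 < q) (hq₂ : 1 / q ≥ 1 / 2 - 1 / ((N : ℝ) + 1 + max c 0))
    (θ : ℝ) (hθ : θ = ((N : ℝ) + 1 + max c 0) * (1 / 2 - 1 / q)) :
    ∃ C > 0, ∀ u : ((Fin N → ℝ) × ℝ) → ℂ, memC u →
      (∫ z in HS N, ‖u z‖ ^ q * (min 1 z.2) ^ c) ^ (1 / q) ≤
        C * ((∫ z in HS N, ‖u z‖ ^ 2 * (min 1 z.2) ^ c) ^ (1 / 2 : ℝ) +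
            (∫ z in HS N, gradSqC u z * (min 1 z.2) ^ c) ^ (1 / 2 : ℝ)) ^ θ *
          ((∫ z in HS N, ‖u z‖ ^ 2 * (min 1 z.2) ^ c) ^ (1 / 2 : ℝ)) ^ (1 - θ) := by
  have hN' : (1 : ℝ) ≤ N := by exact_mod_cast hN
  have hD : 2 ≤ (N : ℝ) + 1 + max c 0 := by
    have := le_max_right c 0
    linarith
  obtain ⟨K, hK, hsob⟩ := sob N hN c
  set D := (N : ℝ) + 1 + max c 0 with hDdef
  clear_value D
  obtain ⟨Q, hqQ, hQ1, hQ2⟩ := exists_Q D q hD hq₁ hq₂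
  have hD0 : 0 < D := by linarith
  have hD1 : 0 < D - 1 := by linarith
  have hQ : 2 < Q := by linarith
  set s := Q * (D - 1) / D with hs
  have hs2 : 2 ≤ s := by rw [hs, le_div_iff₀ hD0]; exact hQ1
  have hsp : s * (D / (D - 1)) = Q := by rw [hs]; field_simp
  have hr2 : 2 ≤ 2 * s - 2 := by linarith
  have hrQ : 2 * s - 2 ≤ Q := by
    have : 2 * s ≤ Q + 2 := by
      rw [hs, mul_div_assoc', div_le_iff₀ hD0]
      nlinarith
    linarith
  refine ⟨Real.exp ((q - 2) * (D - 1) * (Real.log (K.toReal + 1) +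
    D / (D - 1) * Real.log s) / (2 * q)), Real.exp_pos _, ?_⟩
  rintro u ⟨hu', h2u, -⟩
  have hu : ContDiff ℝ 1 u := hu'.of_le (by exact_mod_cast le_top)
  have hum : Measurable fun z => ‖u z‖ₑ := hu.continuous.measurable.enorm
  have hrm : Measurable fun z : (Fin N → ℝ) × ℝ => rho c z.2 := (rho_meas c).comp measurable_snd
  have hpow : ∀ p : ℝ, 0 < p → ∀ z, ENNReal.ofReal (‖u z‖ ^ p) = ‖u z‖ₑ ^ p := by
    intro p hp z
    rw [← ofReal_norm (u z), ENNReal.ofReal_rpow_of_nonneg (norm_nonneg _) hp.le]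
  have hcont : ∀ p : ℝ, 0 < p → Continuous fun z => ‖u z‖ ^ p := fun p hp =>
    hu.continuous.norm.rpow_const fun _ => Or.inr hp.le
  have hfin : ∀ p : ℝ, 0 < p → ∫⁻ z, ‖u z‖ₑ ^ p * rho c z.2 ∂(hsM N) ≠ ⊤ := by
    intro p hp
    have h := fin_int N c hc (fun z => ‖u z‖ ^ p) (hcont p hp) ?_
    · simpa only [hpow p hp] using h
    · refine h2u.mono ?_
      intro z hz h
      apply hz
      simp only [h, norm_zero]
      exact Real.zero_rpow hp.ne'
  have hgfin := fin_int N c hc (gradSqC u) (gradSqC_cont u hu) (gradSqC_supp u h2u)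
  have e1 : ∀ p : ℝ, 0 < p → ∫ z in HS N, ‖u z‖ ^ p * (min 1 z.2) ^ c =
      (∫⁻ z, ‖u z‖ₑ ^ p * rho c z.2 ∂(hsM N)).toReal := by
    intro p hp
    rw [real_int N c _ (hcont p hp) (fun z => by positivity)]
    simp only [hpow p hp]
  have e2 : ∫ z in HS N, ‖u z‖ ^ 2 * (min 1 z.2) ^ c =
      (∫⁻ z, ‖u z‖ₑ ^ (2 : ℝ) * rho c z.2 ∂(hsM N)).toReal := by
    rw [← e1 2 two_pos]
    simp only [Real.rpow_two]
  rw [e1 q (by linarith), e2, real_int N c _ (gradSqC_cont u hu) (gradSqC_nonneg u)]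
  have m1 := mainIneq N c (D / (D - 1)) s hs2 K (by positivity) hsob u hu h2u
  rw [hsp] at m1
  have m2 := interp (hsM N) (fun z => ‖u z‖ₑ) (fun z => rho c z.2) hum hrm (2 * s - 2) Q hQ hr2 hrQ
  have m3 := interp (hsM N) (fun z => ‖u z‖ₑ) (fun z => rho c z.2) hum hrm q Q hQ hq₁.le hqQ
  have f2 := hfin 2 two_pos
  have fQ := hfin Q (by linarith)
  have fq := hfin q (by linarith)
  have fr := hfin (2 * s - 2) (by linarith)
  have hzero : ∫⁻ z, ‖u z‖ₑ ^ (2 : ℝ) * rho c z.2 ∂(hsM N) = 0 →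
      ∫⁻ z, ‖u z‖ₑ ^ q * rho c z.2 ∂(hsM N) = 0 := by
    intro h
    have hmm : ∀ p : ℝ, Measurable fun z => ‖u z‖ₑ ^ p * rho c z.2 := fun p =>
      (hum.pow_const p).mul hrm
    rw [lintegral_eq_zero_iff (hmm 2)] at h
    rw [lintegral_eq_zero_iff (hmm q)]
    filter_upwards [h] with z hz
    simp only [Pi.zero_apply, mul_eq_zero, Pi.mul_apply] at hz ⊢
    rcases hz with hz | hz
    · left
      rw [ENNReal.rpow_eq_zero_iff_of_pos (by norm_num)] at hz
      rw [hz, ENNReal.zero_rpow_of_pos (by linarith)]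
    · exact Or.inr hz
  generalize ∫⁻ z, ‖u z‖ₑ ^ (2 : ℝ) * rho c z.2 ∂(hsM N) = a at *
  generalize ∫⁻ z, ‖u z‖ₑ ^ Q * rho c z.2 ∂(hsM N) = X at *
  generalize ∫⁻ z, ‖u z‖ₑ ^ q * rho c z.2 ∂(hsM N) = Xq at *
  generalize ∫⁻ z, ‖u z‖ₑ ^ (2 * s - 2) * rho c z.2 ∂(hsM N) = Xr at *
  generalize ∫⁻ z, ENNReal.ofReal (gradSqC u z) * rho c z.2 ∂(hsM N) = g at *
  have tp : ∀ (t : ℝ≥0∞) (p : ℝ), t ≠ ⊤ → 0 ≤ p → t ^ p ≠ ⊤ := fun t p ht hp =>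
    ENNReal.rpow_ne_top_of_nonneg hp ht
  by_cases ha : a = 0
  · rw [hzero ha, ENNReal.toReal_zero, Real.zero_rpow (by positivity)]
    positivity
  have ha' : 0 < a.toReal := ENNReal.toReal_pos ha f2
  have hA : 0 < a.toReal ^ (1 / 2 : ℝ) + g.toReal ^ (1 / 2 : ℝ) := by positivity
  have hQ0 : 0 < Q - 2 := by linarith
  refine real_alg D Q q θ (K.toReal + 1) s hD hq₁ hqQ hθ (by positivity) (by positivity)
    a.toReal X.toReal Xr.toReal Xq.toReal _ ha' ENNReal.toReal_nonneg ENNReal.toReal_nonneg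
    ENNReal.toReal_nonneg hA ?_ ?_ ?_
  · have h := ENNReal.toReal_mono ?_ m1
    · rw [ENNReal.toReal_mul, ← ENNReal.toReal_rpow, ENNReal.toReal_mul, ENNReal.toReal_mul,
        ENNReal.toReal_ofReal (by linarith), ENNReal.toReal_add (tp _ _ f2 (by norm_num))
        (tp _ _ hgfin (by norm_num)), ← ENNReal.toReal_rpow, ← ENNReal.toReal_rpow,
        ← ENNReal.toReal_rpow] at h
      refine h.trans ?_
      refine mul_le_mul_of_nonneg_right (by linarith) (by positivity)
    · refine ENNReal.mul_ne_top hK (tp _ _ ?_ (by positivity))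
      refine ENNReal.mul_ne_top ENNReal.ofReal_ne_top (ENNReal.mul_ne_top
        (tp _ _ fr (by norm_num)) (ENNReal.add_ne_top.2
        ⟨tp _ _ f2 (by norm_num), tp _ _ hgfin (by norm_num)⟩))
  · have h := ENNReal.toReal_mono ?_ m2
    · rw [ENNReal.toReal_mul, ← ENNReal.toReal_rpow, ← ENNReal.toReal_rpow] at h
      exact h
    · exact ENNReal.mul_ne_top (tp _ _ f2 (div_nonneg (by linarith) hQ0.le))
        (tp _ _ fQ (div_nonneg (by linarith) hQ0.le))
  · have h := ENNReal.toReal_mono ?_ m3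
    · rw [ENNReal.toReal_mul, ← ENNReal.toReal_rpow, ← ENNReal.toReal_rpow] at h
      exact h
    · exact ENNReal.mul_ne_top (tp _ _ f2 (div_nonneg (by linarith) hQ0.le))
        (tp _ _ fQ (div_nonneg (by linarith) hQ0.le))
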